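/- The map φ is a well-defined homeomorphism from F onto F: for every ((c₁:c₁'),(c₂:c₂'),(c₃:c₃')) ∈ F the triple ((c₁ : c₁ − c₁'), (c₂ : c₂ − c₂'), ((c₁ − c₁')c₂'c₃ : c₁'(c₂ − c₂')c₃')) again lies in F, and the resulting map F → F is a homeomorphism. (This is the transition homeomorphism f₁₂,₁₃ : F₁₂ → F₁₃ between the coordinate records of the space of parameters of the main stratum of G_{5,2} in the charts M₁₂ and M₁₃.) -/

import Mathlib

open scoped LinearAlgebra.Projectivization

/-- The quotient topology on the complex projective line. -/
noncomputable instance : TopologicalSpace (ℙ ℂ (Fin 2 → ℂ)) := instTopologicalSpaceQuotient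

/-- The point of the complex projective line with homogeneous coordinates `(a : b)`. -/
noncomputable def pt (a b : ℂ) (h : a ≠ 0 ∨ b ≠ 0) : ℙ ℂ (Fin 2 → ℂ) :=
  Projectivization.mk ℂ ![a, b] (fun hz => by
    rcases h with h | h
    · exact h (by simpa using congrFun hz 0)
    · exact h (by simpa using congrFun hz 1))

/-- The space of parameters `F` of the main stratum of `G_{5,2}`, as a subset of
`ℂP¹ × ℂP¹ × ℂP¹`: triples `((c₁:c₁'), (c₂:c₂'), (c₃:c₃'))` with `c₁c₂'c₃ = c₁'c₂c₃'` and
`cᵢ, cᵢ' ≠ 0`, `cᵢ ≠ cᵢ'`. -/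
def Fset : Set (ℙ ℂ (Fin 2 → ℂ) × ℙ ℂ (Fin 2 → ℂ) × ℙ ℂ (Fin 2 → ℂ)) :=
  {p | ∃ (c₁ c₁' c₂ c₂' c₃ c₃' : ℂ) (h₁ : c₁ ≠ 0) (h₂ : c₂ ≠ 0) (h₃ : c₃ ≠ 0),
    c₁' ≠ 0 ∧ c₂' ≠ 0 ∧ c₃' ≠ 0 ∧ c₁ ≠ c₁' ∧ c₂ ≠ c₂' ∧ c₃ ≠ c₃' ∧
    c₁ * c₂' * c₃ = c₁' * c₂ * c₃' ∧
    p = (pt c₁ c₁' (Or.inl h₁), pt c₂ c₂' (Or.inl h₂), pt c₃ c₃' (Or.inl h₃))}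

/-- affine coordinate -/
noncomputable def rat : ℙ ℂ (Fin 2 → ℂ) → ℂ :=
  Projectivization.lift (fun v => v.1 0 / v.1 1) (by
    rintro ⟨a, ha⟩ ⟨b, hb⟩ t h
    have ht : t ≠ 0 := by
      rintro rfl
      exact ha (by simpa using h)
    simp only at h
    simp only [h, Pi.smul_apply, smul_eq_mul]
    exact mul_div_mul_left _ _ ht)

noncomputable def aff (x : ℂ) : ℙ ℂ (Fin 2 → ℂ) := pt x 1 (Or.inr one_ne_zero)

theorem rat_pt (a b : ℂ) (h : a ≠ 0 ∨ b ≠ 0) : rat (pt a b h) = a / b := rfl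

theorem pt_eq (a b : ℂ) (h : a ≠ 0 ∨ b ≠ 0) (hb : b ≠ 0) : pt a b h = aff (a / b) := by
  unfold aff pt
  rw [Projectivization.mk_eq_mk_iff']
  refine ⟨b, ?_⟩
  ext i
  fin_cases i
  · simp; field_simp
  · simp

theorem rat_aff (x : ℂ) : rat (aff x) = x := by simp [aff, rat_pt]

theorem aff_cont : Continuous aff := by
  have : Continuous (fun x : ℂ => (⟨![x, 1], fun h => one_ne_zero (congrFun h 1)⟩ :
      {v : Fin 2 → ℂ // v ≠ 0})) := by
    refine Continuous.subtype_mk ?_ _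
    fun_prop
  exact continuous_quotient_mk'.comp this

def U : Set (ℙ ℂ (Fin 2 → ℂ)) :=
  {p | Projectivization.lift (fun v : {v : Fin 2 → ℂ // v ≠ 0} => v.1 1 ≠ 0) (by
    rintro ⟨a, ha⟩ ⟨b, hb⟩ t h
    have ht : t ≠ 0 := by
      rintro rfl
      exact ha (by simpa using h)
    simp only at h
    simp [h, ht]) p}

theorem aff_mem (x : ℂ) : aff x ∈ U := by
  change (![x, 1] : Fin 2 → ℂ) 1 ≠ 0
  simp

theorem rat_cont : ContinuousOn rat U := by
  have hq : Topology.IsQuotientMap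
      (Quotient.mk (projectivizationSetoid ℂ (Fin 2 → ℂ))) := isQuotientMap_quotient_mk'
  have hc (i : Fin 2) : Continuous (fun v : {v : Fin 2 → ℂ // v ≠ 0} => v.1 i) :=
    (continuous_apply i).comp continuous_subtype_val
  have hU : IsOpen U := by
    refine hq.isOpen_preimage.1 ?_
    change IsOpen {v : {v : Fin 2 → ℂ // v ≠ 0} | v.1 1 ≠ 0}
    exact isOpen_ne_fun (hc 1) continuous_const
  refine (hq.continuousOn_isOpen_iff hU).2 ?_
  change ContinuousOn (fun v : {v : Fin 2 → ℂ // v ≠ 0} => v.1 0 / v.1 1) {v | v.1 1 ≠ 0}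
  exact ContinuousOn.div (hc 0).continuousOn (hc 1).continuousOn (fun v hv => hv)

theorem mem_iff (x y z : ℂ) (hx : x ≠ 0) (hy : y ≠ 0) (hz : z ≠ 0) (hx1 : x ≠ 1) (hy1 : y ≠ 1)
    (hz1 : z ≠ 1) (h : x * z = y) : (aff x, aff y, aff z) ∈ Fset :=
  ⟨x, 1, y, 1, z, 1, hx, hy, hz, one_ne_zero, one_ne_zero, one_ne_zero, hx1, hy1, hz1,
    by simpa using h, rfl⟩

theorem mem_elim {p} (hp : p ∈ Fset) : ∃ x y z : ℂ, x ≠ 0 ∧ y ≠ 0 ∧ z ≠ 0 ∧ x ≠ 1 ∧ y ≠ 1 ∧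
    z ≠ 1 ∧ x * z = y ∧ p = (aff x, aff y, aff z) := by
  obtain ⟨a, a', b, b', c, c', ha, hb, hc, ha', hb', hc', h1, h2, h3, h, rfl⟩ := hp
  refine ⟨a / a', b / b', c / c', div_ne_zero ha ha', div_ne_zero hb hb', div_ne_zero hc hc',
    ?_, ?_, ?_, ?_, ?_⟩
  · rwa [Ne, div_eq_one_iff_eq ha']
  · rwa [Ne, div_eq_one_iff_eq hb']
  · rwa [Ne, div_eq_one_iff_eq hc']
  · field_simp
    linear_combination h
  · rw [pt_eq _ _ _ ha', pt_eq _ _ _ hb', pt_eq _ _ _ hc']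

theorem image_mem (x y z : ℂ) (hx : x ≠ 0) (hy : y ≠ 0) (hz : z ≠ 0) (hx1 : x ≠ 1) (hy1 : y ≠ 1)
    (hz1 : z ≠ 1) (h : x * z = y) :
    (aff (x / (x - 1)), aff (y / (y - 1)), aff ((x - 1) * z / (y - 1))) ∈ Fset := by
  have hx' := sub_ne_zero.2 hx1
  have hy' := sub_ne_zero.2 hy1
  refine mem_iff _ _ _ (div_ne_zero hx hx') (div_ne_zero hy hy')
    (div_ne_zero (mul_ne_zero hx' hz) hy') ?_ ?_ ?_ ?_
  · rw [Ne, div_eq_one_iff_eq hx']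
    intro e; exact one_ne_zero (α := ℂ) (by linear_combination e)
  · rw [Ne, div_eq_one_iff_eq hy']
    intro e; exact one_ne_zero (α := ℂ) (by linear_combination e)
  · rw [Ne, div_eq_one_iff_eq hy']
    intro e; exact hz1 (by linear_combination h - e)
  · field_simp
    linear_combination h

noncomputable def T (p : ℙ ℂ (Fin 2 → ℂ) × ℙ ℂ (Fin 2 → ℂ) × ℙ ℂ (Fin 2 → ℂ)) :
    ℙ ℂ (Fin 2 → ℂ) × ℙ ℂ (Fin 2 → ℂ) × ℙ ℂ (Fin 2 → ℂ) :=
  (aff (rat p.1 / (rat p.1 - 1)), aff (rat p.2.1 / (rat p.2.1 - 1)),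
    aff ((rat p.1 - 1) * rat p.2.2 / (rat p.2.1 - 1)))

theorem T_mem {p} (hp : p ∈ Fset) : T p ∈ Fset := by
  obtain ⟨x, y, z, hx, hy, hz, hx1, hy1, hz1, h, rfl⟩ := mem_elim hp
  simp only [T, rat_aff]
  exact image_mem x y z hx hy hz hx1 hy1 hz1 h

theorem T_T {p} (hp : p ∈ Fset) : T (T p) = p := by
  obtain ⟨x, y, z, hx, hy, hz, hx1, hy1, hz1, h, rfl⟩ := mem_elim hp
  have hx' := sub_ne_zero.2 hx1
  have hy' := sub_ne_zero.2 hy1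
  have ex : x / (x - 1) - 1 = 1 / (x - 1) := by field_simp; ring
  have ey : y / (y - 1) - 1 = 1 / (y - 1) := by field_simp; ring
  simp only [T, rat_aff, ex, ey]
  congr 2
  · field_simp
  · congr 1
    field_simp
  · congr 1
    field_simp

theorem T_cont : ContinuousOn T Fset := by
  have m : ∀ p ∈ Fset, (p.1 ∈ U ∧ p.2.1 ∈ U ∧ p.2.2 ∈ U) ∧ rat p.1 - 1 ≠ 0 ∧
      rat p.2.1 - 1 ≠ 0 := by
    intro p hp
    obtain ⟨x, y, z, hx, hy, hz, hx1, hy1, hz1, h, rfl⟩ := mem_elim hp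
    simp only [rat_aff]
    exact ⟨⟨aff_mem _, aff_mem _, aff_mem _⟩, sub_ne_zero.2 hx1, sub_ne_zero.2 hy1⟩
  have c1 : ContinuousOn (fun p : ℙ ℂ (Fin 2 → ℂ) × ℙ ℂ (Fin 2 → ℂ) × ℙ ℂ (Fin 2 → ℂ) =>
      rat p.1) Fset := rat_cont.comp (by fun_prop) (fun p hp => (m p hp).1.1)
  have c2 : ContinuousOn (fun p : ℙ ℂ (Fin 2 → ℂ) × ℙ ℂ (Fin 2 → ℂ) × ℙ ℂ (Fin 2 → ℂ) =>
      rat p.2.1) Fset := rat_cont.comp (by fun_prop) (fun p hp => (m p hp).1.2.1)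
  have c3 : ContinuousOn (fun p : ℙ ℂ (Fin 2 → ℂ) × ℙ ℂ (Fin 2 → ℂ) × ℙ ℂ (Fin 2 → ℂ) =>
      rat p.2.2) Fset := rat_cont.comp (by fun_prop) (fun p hp => (m p hp).1.2.2)
  refine ContinuousOn.prodMk ?_ (ContinuousOn.prodMk ?_ ?_)
  · exact aff_cont.comp_continuousOn
      (c1.div (c1.sub continuousOn_const) (fun p hp => (m p hp).2.1))
  · exact aff_cont.comp_continuousOn
      (c2.div (c2.sub continuousOn_const) (fun p hp => (m p hp).2.2))
  · exact aff_cont.comp_continuousOn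
      (((c1.sub continuousOn_const).mul c3).div (c2.sub continuousOn_const)
        (fun p hp => (m p hp).2.2))

noncomputable def Thomeo : Fset ≃ₜ Fset where
  toFun p := ⟨T p.1, T_mem p.2⟩
  invFun p := ⟨T p.1, T_mem p.2⟩
  left_inv p := Subtype.ext (T_T p.2)
  right_inv p := Subtype.ext (T_T p.2)
  continuous_toFun := (continuousOn_iff_continuous_domRestrict.1 T_cont).subtype_mk _
  continuous_invFun := (continuousOn_iff_continuous_domRestrict.1 T_cont).subtype_mk _

theorem T_eq (c₁ c₁' c₂ c₂' c₃ c₃' : ℂ) (h₁ : c₁ ≠ 0) (h₂ : c₂ ≠ 0) (h₃ : c₃ ≠ 0)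
      (h₁' : c₁' ≠ 0) (h₂' : c₂' ≠ 0) (h₃' : c₃' ≠ 0)
      (h₁₁ : c₁ ≠ c₁') (h₂₂ : c₂ ≠ c₂') :
    T (pt c₁ c₁' (Or.inl h₁), pt c₂ c₂' (Or.inl h₂), pt c₃ c₃' (Or.inl h₃)) =
      (pt c₁ (c₁ - c₁') (Or.inl h₁), pt c₂ (c₂ - c₂') (Or.inl h₂),
        pt ((c₁ - c₁') * c₂' * c₃) (c₁' * (c₂ - c₂') * c₃')
          (Or.inl (mul_ne_zero (mul_ne_zero (sub_ne_zero.mpr h₁₁) h₂') h₃))) := by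
  have k1 := sub_ne_zero.2 h₁₁
  have k2 := sub_ne_zero.2 h₂₂
  have e1 : c₁ / c₁' - 1 = (c₁ - c₁') / c₁' := by field_simp
  have e2 : c₂ / c₂' - 1 = (c₂ - c₂') / c₂' := by field_simp
  rw [pt_eq _ _ _ k1, pt_eq _ _ _ k2, pt_eq _ _ _ (mul_ne_zero (mul_ne_zero h₁' k2) h₃')]
  simp only [T, rat_pt, e1, e2]
  congr 2
  · field_simp
  · congr 1
    field_simp
  · congr 1
    field_simp

/-- The transition map `f₁₂,₁₃` between the coordinate records of the space of parameters of the
main stratum of `G_{5,2}` in the charts `M₁₂` and `M₁₃`,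
`((c₁:c₁'), (c₂:c₂'), (c₃:c₃')) ↦ ((c₁ : c₁-c₁'), (c₂ : c₂-c₂'), ((c₁-c₁')c₂'c₃ : c₁'(c₂-c₂')c₃'))`,
is well defined on `F` and is a homeomorphism of `F` onto itself. -/
theorem transition_homeomorphism_of_parameter_space :
    (∀ (c₁ c₁' c₂ c₂' c₃ c₃' : ℂ) (h₁ : c₁ ≠ 0) (h₂ : c₂ ≠ 0) (h₃ : c₃ ≠ 0)
      (h₁' : c₁' ≠ 0) (h₂' : c₂' ≠ 0) (h₃' : c₃' ≠ 0)
      (h₁₁ : c₁ ≠ c₁') (h₂₂ : c₂ ≠ c₂') (h₃₃ : c₃ ≠ c₃')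
      (hcubic : c₁ * c₂' * c₃ = c₁' * c₂ * c₃'),
      (pt c₁ (c₁ - c₁') (Or.inl h₁), pt c₂ (c₂ - c₂') (Or.inl h₂),
        pt ((c₁ - c₁') * c₂' * c₃) (c₁' * (c₂ - c₂') * c₃')
          (Or.inl (mul_ne_zero (mul_ne_zero (sub_ne_zero.mpr h₁₁) h₂') h₃))) ∈ Fset) ∧
    ∃ ψ : Fset ≃ₜ Fset,
      ∀ (p : Fset) (c₁ c₁' c₂ c₂' c₃ c₃' : ℂ) (h₁ : c₁ ≠ 0) (h₂ : c₂ ≠ 0) (h₃ : c₃ ≠ 0)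
        (h₁' : c₁' ≠ 0) (h₂' : c₂' ≠ 0) (h₃' : c₃' ≠ 0)
        (h₁₁ : c₁ ≠ c₁') (h₂₂ : c₂ ≠ c₂') (h₃₃ : c₃ ≠ c₃')
        (hcubic : c₁ * c₂' * c₃ = c₁' * c₂ * c₃'),
        p.1 = (pt c₁ c₁' (Or.inl h₁), pt c₂ c₂' (Or.inl h₂), pt c₃ c₃' (Or.inl h₃)) →
        (ψ p).1 = (pt c₁ (c₁ - c₁') (Or.inl h₁), pt c₂ (c₂ - c₂') (Or.inl h₂),
          pt ((c₁ - c₁') * c₂' * c₃) (c₁' * (c₂ - c₂') * c₃')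
            (Or.inl (mul_ne_zero (mul_ne_zero (sub_ne_zero.mpr h₁₁) h₂') h₃))) := by
  refine ⟨?_, Thomeo, ?_⟩
  · intro c₁ c₁' c₂ c₂' c₃ c₃' h₁ h₂ h₃ h₁' h₂' h₃' h₁₁ h₂₂ h₃₃ hcubic
    rw [← T_eq c₁ c₁' c₂ c₂' c₃ c₃' h₁ h₂ h₃ h₁' h₂' h₃' h₁₁ h₂₂]
    exact T_mem ⟨c₁, c₁', c₂, c₂', c₃, c₃', h₁, h₂, h₃, h₁', h₂', h₃', h₁₁, h₂₂, h₃₃, hcubic, rfl⟩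
  · intro p c₁ c₁' c₂ c₂' c₃ c₃' h₁ h₂ h₃ h₁' h₂' h₃' h₁₁ h₂₂ h₃₃ hcubic hp
    rw [← T_eq c₁ c₁' c₂ c₂' c₃ c₃' h₁ h₂ h₃ h₁' h₂' h₃' h₁₁ h₂₂, ← hp]
    rfl
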